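/- arXiv:2510.09932 — 2 statements merged into one kernel-verified Lean document; each statement's English description precedes it below -/
import Mathlib

section
/- Let α be a type, M X : List α, and s₁, e₁, s₂, e₂ natural numbers with s₂ ≤ e₂, e₂ ≤ M.length, and X.length = e₂ - s₂. If the intervals [s₁,e₁) and [s₂,e₂) are disjoint (i.e., e₁ ≤ s₂ or e₂ ≤ s₁), then slice(upslice(M, X, s₂, e₂), s₁, e₁) = slice(M, s₁, e₁). -/
/-- `listSlice L s e` reads the sub-tensor `L[s:e]`. -/
def listSlice {α : Type*} (L : List α) (s e : ℕ) : List α :=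
  (L.drop s).take (e - s)

/-- `upslice M X s e` updates the sub-tensor `M[s:e]` to `X`. -/
def upslice {α : Type*} (M X : List α) (s e : ℕ) : List α :=
  M.take s ++ X ++ M.drop e

/-- Rewrite rule `slice_{[s1:e1]}(upslice_{[s2:e2]}(M,X)) → slice_{[s1:e1]}(M)`
under the disjointness precondition. -/
theorem slice_upslice_disjoint {α : Type*} (M X : List α) (s₁ e₁ s₂ e₂ : ℕ)
    (h₁ : s₂ ≤ e₂) (h₂ : e₂ ≤ M.length) (h₃ : X.length = e₂ - s₂)
    (hdisj : e₁ ≤ s₂ ∨ e₂ ≤ s₁) :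
    listSlice (upslice M X s₂ e₂) s₁ e₁ = listSlice M s₁ e₁ := by
  unfold listSlice upslice
  apply List.ext_getElem?
  intro i
  simp only [List.getElem?_take, List.getElem?_drop, List.getElem?_append,
    List.length_append, List.length_take]
  grind
end

section
/- Let α be a type, f : ℕ → α, and let l be a list of writes, each write being a pair (s, X) with X a list over α and region [s, s + X.length). Assume the regions of the writes in l are pairwise disjoint. Then for any list l' that is a permutation of l, applying the writes of l in order to f (by left fold) yields the same function ℕ → α as applying the writes of l' in order to f. -/
/-- A write `(s, X)` acts on a memory `f : ℕ → α` by overwriting the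
region `[s, s + X.length)` with the data `X`. -/
def applyWrite {α : Type*} (f : ℕ → α) (w : ℕ × List α) : ℕ → α :=
  fun i => if h : w.1 ≤ i ∧ i < w.1 + w.2.length then w.2[i - w.1]'(by omega) else f i

/-- The region of a write `(s, X)` is the interval `[s, s + X.length)`. -/
def writeRegion {α : Type*} (w : ℕ × List α) : Set ℕ :=
  Set.Ico w.1 (w.1 + w.2.length)

/-- Writes to pairwise disjoint regions commute: applying the writes in any
order (any permutation of the list of writes) yields the same memory. -/
theorem foldl_applyWrite_perm {α : Type*} (f : ℕ → α) (l : List (ℕ × List α))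
    (hdisj : l.Pairwise fun w₁ w₂ => Disjoint (writeRegion w₁) (writeRegion w₂)) :
    ∀ l' : List (ℕ × List α), l.Perm l' →
      l.foldl applyWrite f = l'.foldl applyWrite f := by
  intro l' hp
  induction hp generalizing f with
  | nil => rfl
  | cons x _ ih =>
    simp only [List.foldl_cons]
    exact ih _ (List.pairwise_cons.1 hdisj).2
  | swap x y l =>
    simp only [List.foldl_cons]
    congr 1
    have h : Disjoint (writeRegion y) (writeRegion x) :=
      (List.pairwise_cons.1 hdisj).1 x (by simp)
    funext i
    have hi : i ∈ writeRegion y → i ∉ writeRegion x := fun hy => Set.disjoint_left.1 h hy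
    simp only [writeRegion, Set.mem_Ico] at hi
    unfold applyWrite
    by_cases h1 : y.1 ≤ i ∧ i < y.1 + y.2.length
    · have h2 := hi h1
      simp only [dif_pos h1, dif_neg h2]
    · simp only [dif_neg h1]
  | trans h1 _ ih1 ih2 =>
    refine (ih1 f hdisj).trans (ih2 f ?_)
    exact h1.pairwise hdisj (fun h => h.symm)
end
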